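/- arXiv:1006.4343 — 2 statements merged into one kernel-verified Lean document; each statement's English description precedes it below -/
import Mathlib

section
/- For any exact category E and any boundedness condition * ∈ {bounded above, bounded below, bounded}, a *-bounded complex over E is acyclic if and only if it is a direct summand (in the homotopy category) of a *-bounded exact complex. -/
open CategoryTheory CategoryTheory.Limits ZeroObject

universe v u

/-- The data of a class of "admissible triples" on a category: a predicate on composable
pairs of morphisms `X ⟶ Y ⟶ Z`. -/
structure ExData (C : Type u) [Category.{v} C] where
  adm : ∀ ⦃X Y Z : C⦄, (X ⟶ Y) → (Y ⟶ Z) → Prop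

namespace ExData

variable {C : Type u} [Category.{v} C] [Preadditive C]

/-- A morphism is an admissible monomorphism if it is the first map of an admissible triple. -/
def AdmMono (E : ExData C) {X Y : C} (f : X ⟶ Y) : Prop := ∃ (Z : C) (g : Y ⟶ Z), E.adm f g

/-- A morphism is an admissible epimorphism if it is the second map of an admissible triple. -/
def AdmEpi (E : ExData C) {Y Z : C} (g : Y ⟶ Z) : Prop := ∃ (X : C) (f : X ⟶ Y), E.adm f g

/-- Axiom Ex0: the zero triple is admissible and the class of admissible triples is closed
under isomorphism of triples. -/
def Ex0 [HasZeroObject C] (E : ExData C) : Prop :=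
  E.adm (𝟙 (0 : C)) (𝟙 (0 : C)) ∧
  ∀ ⦃X Y Z X' Y' Z' : C⦄ (f : X ⟶ Y) (g : Y ⟶ Z) (f' : X' ⟶ Y') (g' : Y' ⟶ Z')
    (a : X ≅ X') (b : Y ≅ Y') (c : Z ≅ Z'),
    E.adm f g → f ≫ b.hom = a.hom ≫ f' → g ≫ c.hom = b.hom ≫ g' → E.adm f' g'

/-- Axiom Ex1: in an admissible triple `X ⟶ Y ⟶ Z` the two morphisms are each other's
kernel and cokernel. -/
def Ex1 (E : ExData C) : Prop :=
  ∀ ⦃X Y Z : C⦄ (f : X ⟶ Y) (g : Y ⟶ Z), E.adm f g →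
    f ≫ g = 0 ∧
    (∀ ⦃T : C⦄ (h : T ⟶ Y), h ≫ g = 0 → ∃! k : T ⟶ X, k ≫ f = h) ∧
    (∀ ⦃T : C⦄ (h : Y ⟶ T), f ≫ h = 0 → ∃! k : Z ⟶ T, g ≫ k = h)

/-- Axiom Ex2(a): pushout of an admissible triple along a morphism out of its first term. -/
def Ex2a (E : ExData C) : Prop :=
  ∀ ⦃X' X X'' Y' : C⦄ (f : X' ⟶ X) (g : X ⟶ X''), E.adm f g → ∀ (t : X' ⟶ Y'),
    ∃ (Y : C) (i : Y' ⟶ Y) (u : X ⟶ Y) (g' : Y ⟶ X''),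
      E.adm i g' ∧ t ≫ i = f ≫ u ∧ u ≫ g' = g

/-- Axiom Ex2(b): pullback of an admissible triple along a morphism into its last term. -/
def Ex2b (E : ExData C) : Prop :=
  ∀ ⦃X' X X'' Y'' : C⦄ (f : X' ⟶ X) (g : X ⟶ X''), E.adm f g → ∀ (t : Y'' ⟶ X''),
    ∃ (Y : C) (f' : X' ⟶ Y) (u : Y ⟶ X) (g' : Y ⟶ Y''),
      E.adm f' g' ∧ f' ≫ u = f ∧ u ≫ g = g' ≫ t

/-- Axiom Ex3(a): the composition of two admissible monomorphisms is an admissible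
monomorphism. -/
def Ex3a (E : ExData C) : Prop :=
  ∀ ⦃X Y Z : C⦄ (f : X ⟶ Y) (g : Y ⟶ Z), E.AdmMono f → E.AdmMono g → E.AdmMono (f ≫ g)

/-- Axiom Ex3(b): the composition of two admissible epimorphisms is an admissible
epimorphism. -/
def Ex3b (E : ExData C) : Prop :=
  ∀ ⦃X Y Z : C⦄ (f : X ⟶ Y) (g : Y ⟶ Z), E.AdmEpi f → E.AdmEpi g → E.AdmEpi (f ≫ g)

/-- The full set of exact category axioms Ex0–Ex3. -/
structure IsExact [HasZeroObject C] (E : ExData C) : Prop where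
  ex0 : E.Ex0
  ex1 : E.Ex1
  ex2a : E.Ex2a
  ex2b : E.Ex2b
  ex3a : E.Ex3a
  ex3b : E.Ex3b

end ExData

variable {C : Type u} [Category.{v} C] [Preadditive C] [HasZeroObject C]

/-- A complex over an exact category is exact if its differentials factor as
admissible epimorphisms followed by admissible monomorphisms through a sequence of
admissible triples `Z^i → X^i → Z^{i+1}`. -/
def IsExactCpx (E : ExData C) (K : CochainComplex C ℤ) : Prop :=
  ∃ (Z : ℤ → C) (p : ∀ i : ℤ, K.X i ⟶ Z (i + 1)) (j : ∀ i : ℤ, Z i ⟶ K.X i),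
    (∀ i : ℤ, E.adm (j i) (p i)) ∧ ∀ i : ℤ, K.d i (i + 1) = p i ≫ j (i + 1)

/-- A complex is acyclic if it is homotopy equivalent to an exact complex. -/
def IsAcyclicCpx (E : ExData C) (K : CochainComplex C ℤ) : Prop :=
  ∃ L : CochainComplex C ℤ, IsExactCpx E L ∧ Nonempty (HomotopyEquiv K L)

/-- Bounded above complexes: `K.X i = 0` for `i ≫ 0`. -/
def CpxBddAbove (K : CochainComplex C ℤ) : Prop :=
  ∃ n : ℤ, ∀ i : ℤ, n ≤ i → IsZero (K.X i)

/-- Bounded below complexes: `K.X i = 0` for `i ≪ 0`. -/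
def CpxBddBelow (K : CochainComplex C ℤ) : Prop :=
  ∃ n : ℤ, ∀ i : ℤ, i ≤ n → IsZero (K.X i)

namespace ExAux

open ExData

theorem adm_comp {E : ExData C} (hE : E.IsExact) {X Y Z : C} {f : X ⟶ Y} {g : Y ⟶ Z}
    (h : E.adm f g) : f ≫ g = 0 := (hE.ex1 f g h).1

theorem adm_lift {E : ExData C} (hE : E.IsExact) {X Y Z : C} {f : X ⟶ Y} {g : Y ⟶ Z}
    (h : E.adm f g) {T : C} (a : T ⟶ Y) (ha : a ≫ g = 0) : ∃ k : T ⟶ X, k ≫ f = a :=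
  ((hE.ex1 f g h).2.1 a ha).exists

theorem adm_desc {E : ExData C} (hE : E.IsExact) {X Y Z : C} {f : X ⟶ Y} {g : Y ⟶ Z}
    (h : E.adm f g) {T : C} (a : Y ⟶ T) (ha : f ≫ a = 0) : ∃ k : Z ⟶ T, g ≫ k = a :=
  ((hE.ex1 f g h).2.2 a ha).exists

theorem adm_mono {E : ExData C} (hE : E.IsExact) {X Y Z : C} {f : X ⟶ Y} {g : Y ⟶ Z}
    (h : E.adm f g) : Mono f := ⟨fun {T} a b hab => by
  have h0 := adm_comp hE h
  exact ((hE.ex1 f g h).2.1 (b ≫ f) (by simp [h0])).unique hab rfl⟩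

theorem adm_epi {E : ExData C} (hE : E.IsExact) {X Y Z : C} {f : X ⟶ Y} {g : Y ⟶ Z}
    (h : E.adm f g) : Epi g := ⟨fun {T} a b hab => by
  have h0 := adm_comp hE h
  exact ((hE.ex1 f g h).2.2 (g ≫ b) (by rw [← Category.assoc, h0, zero_comp])).unique hab rfl⟩

theorem adm_id_zero {E : ExData C} (hE : E.IsExact) {X Z : C} (hZ : IsZero Z) (g : X ⟶ Z) :
    E.adm (𝟙 X) g := by
  obtain ⟨Y, i, u, g', h, -, -⟩ := hE.ex2a (𝟙 (0 : C)) (𝟙 (0 : C)) hE.ex0.1 (0 : 0 ⟶ X)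
  have hm := adm_mono hE h
  obtain ⟨k, hk⟩ := adm_lift hE h (𝟙 Y) ((isZero_zero C).eq_of_tgt _ _)
  have hk' : i ≫ k = 𝟙 X := by rw [← cancel_mono i]; simp [hk]
  exact hE.ex0.2 i g' (𝟙 X) g (Iso.refl X) ⟨k, i, hk, hk'⟩ ((isZero_zero C).iso hZ) h
    (by simpa using hk') (hZ.eq_of_tgt _ _)

theorem adm_zero_id {E : ExData C} (hE : E.IsExact) {X Z : C} (hZ : IsZero Z) (f : Z ⟶ X) :
    E.adm f (𝟙 X) := by
  obtain ⟨Y, f', u, g', h, -, -⟩ := hE.ex2b (𝟙 (0 : C)) (𝟙 (0 : C)) hE.ex0.1 (0 : X ⟶ 0)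
  have hm := adm_epi hE h
  obtain ⟨k, hk⟩ := adm_desc hE h (𝟙 Y) ((isZero_zero C).eq_of_src _ _)
  have hk' : k ≫ g' = 𝟙 X := by rw [← cancel_epi g']; simp [reassoc_of% hk]
  exact hE.ex0.2 f' g' f (𝟙 X) ((isZero_zero C).iso hZ) ⟨g', k, hk, hk'⟩ (Iso.refl X) h
    ((isZero_zero C).eq_of_src _ _) (by simp)

/-- The square of Ex2(b) is a pullback: existence of lifts. -/
theorem pb_lift {E : ExData C} (hE : E.IsExact) {X' X X'' Y Y'' : C} {f : X' ⟶ X} {g : X ⟶ X''}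
    (h : E.adm f g) {t : Y'' ⟶ X''} {f' : X' ⟶ Y} {u : Y ⟶ X} {g' : Y ⟶ Y''}
    (h' : E.adm f' g') (hf : f' ≫ u = f) (hu : u ≫ g = g' ≫ t)
    {T : C} (a : T ⟶ X) (b : T ⟶ Y'') (hab : a ≫ g = b ≫ t) :
    ∃ k : T ⟶ Y, k ≫ u = a ∧ k ≫ g' = b := by
  obtain ⟨Q, f2, v, q, hQ, h1, h2⟩ := hE.ex2b f' g' h' b
  obtain ⟨w, hw⟩ := adm_lift hE h (v ≫ u - q ≫ a) (by
    simp only [Preadditive.sub_comp, Category.assoc, hu, hab, reassoc_of% h2, sub_self])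
  have hm := adm_mono hE h
  have he := adm_epi hE hQ
  have hfw : f2 ≫ w = 𝟙 _ := by
    rw [← cancel_mono f, Category.assoc, hw]
    simp [reassoc_of% h1, hf, reassoc_of% (adm_comp hE hQ)]
  obtain ⟨k, hk⟩ := adm_desc hE hQ (v - w ≫ f') (by
    simp [h1, reassoc_of% hfw])
  refine ⟨k, ?_, ?_⟩
  · rw [← cancel_epi q, reassoc_of% hk]
    simp [hf, hw]
  · rw [← cancel_epi q, reassoc_of% hk]
    simp [adm_comp hE h', h2]

theorem pb_ext {E : ExData C} (hE : E.IsExact) {X' X Y Y'' : C} {f : X' ⟶ X} [Mono f]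
    {f' : X' ⟶ Y} {u : Y ⟶ X} {g' : Y ⟶ Y''}
    (h' : E.adm f' g') (hf : f' ≫ u = f)
    {T : C} (a b : T ⟶ Y) (h1 : a ≫ u = b ≫ u) (h2 : a ≫ g' = b ≫ g') : a = b := by
  obtain ⟨k, hk⟩ := adm_lift hE h' (a - b) (by simp [h2])
  have : k = 0 := by
    rw [← cancel_mono f, ← hf, reassoc_of% hk]; simp [h1]
  rw [this, zero_comp] at hk
  exact (sub_eq_zero.1 hk.symm)

theorem hasBinaryBiproducts {E : ExData C} (hE : E.IsExact) : HasBinaryBiproducts C := by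
  refine ⟨fun X Z => ?_⟩
  have h := adm_id_zero hE (isZero_zero C) (0 : X ⟶ 0)
  obtain ⟨Y, f, u, g, h', hf, hu⟩ := hE.ex2b _ _ h (0 : Z ⟶ 0)
  obtain ⟨k, hk1, hk2⟩ := pb_lift hE h h' hf hu (0 : Z ⟶ X) (𝟙 Z) (by simp)
  have h0 := adm_comp hE h'
  let b : BinaryBicone X Z :=
    { pt := Y, fst := u, snd := g, inl := f, inr := k
      inl_fst := hf, inl_snd := h0, inr_fst := hk1, inr_snd := hk2 }
  refine HasBinaryBiproduct.mk ⟨b, isBinaryBilimitOfTotal b ?_⟩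
  refine pb_ext hE h' hf _ _ ?_ ?_
  · simp [b, hf, hk1]
  · simp [b, h0, hk2]

theorem pb_admEpi {E : ExData C} (hE : E.IsExact) {X' X X'' P Y'' : C} {f : X' ⟶ X} {g : X ⟶ X''}
    (h : E.adm f g) (t : Y'' ⟶ X'') (v : P ⟶ X) (q : P ⟶ Y'') (hc : v ≫ g = q ≫ t)
    (hl : ∀ ⦃T : C⦄ (a : T ⟶ X) (b : T ⟶ Y''), a ≫ g = b ≫ t →
      ∃ k : T ⟶ P, k ≫ v = a ∧ k ≫ q = b)
    (hx : ∀ ⦃T : C⦄ (a b : T ⟶ P), a ≫ v = b ≫ v → a ≫ q = b ≫ q → a = b) :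
    E.AdmEpi q := by
  obtain ⟨Q, f', u, g', h', hf, hu⟩ := hE.ex2b _ _ h t
  obtain ⟨k, hk1, hk2⟩ := hl u g' hu
  obtain ⟨l, hl1, hl2⟩ := pb_lift hE h h' hf hu v q hc
  have := adm_mono hE h
  refine ⟨X', f' ≫ k, hE.ex0.2 f' g' _ q (Iso.refl _) ⟨k, l, ?_, ?_⟩ (Iso.refl _) h' ?_ ?_⟩
  · exact pb_ext hE h' hf _ _ (by simp [hl1, hk1]) (by simp [hl2, hk2])
  · exact hx _ _ (by simp [hl1, hk1]) (by simp [hl2, hk2])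
  · simp
  · simp [hk2]

theorem adm_of_ker {E : ExData C} (hE : E.IsExact) {X Y Z : C} (f : X ⟶ Y) (g : Y ⟶ Z)
    (hg : E.AdmEpi g) [Mono f] (h0 : f ≫ g = 0)
    (hl : ∀ ⦃T : C⦄ (a : T ⟶ Y), a ≫ g = 0 → ∃ k : T ⟶ X, k ≫ f = a) : E.adm f g := by
  obtain ⟨X', f', h⟩ := hg
  have := adm_mono hE h
  obtain ⟨k, hk⟩ := hl f' (adm_comp hE h)
  obtain ⟨l, hl⟩ := adm_lift hE h f h0
  refine hE.ex0.2 f' g f g ⟨k, l, ?_, ?_⟩ (Iso.refl _) (Iso.refl _) h ?_ ?_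
  · rw [← cancel_mono f']; simp [hl, hk]
  · rw [← cancel_mono f]; simp [hl, hk]
  · simp [hk]
  · simp

section
variable [HasBinaryBiproducts C]

theorem adm_inl_snd {E : ExData C} (hE : E.IsExact) (X Y : C) :
    E.adm (biprod.inl : X ⟶ X ⊞ Y) (biprod.snd : X ⊞ Y ⟶ Y) := by
  refine adm_of_ker hE _ _ ?_ (by simp) ?_
  · refine pb_admEpi hE (adm_id_zero hE (isZero_zero C) (0 : X ⟶ 0)) (0 : Y ⟶ 0) biprod.fst
      biprod.snd (by simp) ?_ ?_
    · intro T a b _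
      exact ⟨biprod.lift a b, by simp, by simp⟩
    · intro T a b h1 h2
      exact biprod.hom_ext _ _ h1 h2
  · intro T a ha
    refine ⟨a ≫ biprod.fst, ?_⟩
    ext <;> simp [ha]

theorem adm_biprod {E : ExData C} (hE : E.IsExact) {X Y Z X' Y' Z' : C} {f : X ⟶ Y} {g : Y ⟶ Z}
    {f' : X' ⟶ Y'} {g' : Y' ⟶ Z'} (h : E.adm f g) (h' : E.adm f' g') :
    E.adm (biprod.map f f') (biprod.map g g') := by
  have m1 := adm_mono hE h
  have m2 := adm_mono hE h'
  have z1 := adm_comp hE h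
  have z2 := adm_comp hE h'
  have e1 : E.AdmEpi (biprod.map g (𝟙 Y')) := by
    refine pb_admEpi hE h biprod.fst biprod.fst _ (by simp) ?_ ?_
    · intro T a b hab
      refine ⟨biprod.lift a (b ≫ biprod.snd), by simp, ?_⟩
      ext <;> simp [hab]
    · intro T a b h1 h2
      refine biprod.hom_ext _ _ h1 ?_
      simpa using h2 =≫ biprod.snd
  have e2 : E.AdmEpi (biprod.map (𝟙 Z) g') := by
    refine pb_admEpi hE h' biprod.snd biprod.snd _ (by simp) ?_ ?_
    · intro T a b hab
      refine ⟨biprod.lift (b ≫ biprod.fst) a, by simp, ?_⟩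
      ext <;> simp [hab]
    · intro T a b h1 h2
      refine biprod.hom_ext _ _ ?_ h1
      simpa using h2 =≫ biprod.fst
  have e3 : biprod.map g g' = biprod.map g (𝟙 Y') ≫ biprod.map (𝟙 Z) g' := by
    ext <;> simp
  have m3 : Mono (biprod.map f f') := ⟨fun {T} a b hab => by
    ext
    · rw [← cancel_mono f]
      simpa using hab =≫ biprod.fst
    · rw [← cancel_mono f']
      simpa using hab =≫ biprod.snd⟩
  refine adm_of_ker hE _ _ (e3 ▸ hE.ex3b _ _ e1 e2) ?_ ?_
  · ext <;> simp [z1, z2]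
  · intro T a ha
    obtain ⟨k, hk⟩ := adm_lift hE h (a ≫ biprod.fst) (by simpa using ha =≫ biprod.fst)
    obtain ⟨l, hl⟩ := adm_lift hE h' (a ≫ biprod.snd) (by simpa using ha =≫ biprod.snd)
    refine ⟨biprod.lift k l, ?_⟩
    ext <;> simp [hk, hl]

end

/-- The complex spliced from a sequence of composable pairs. -/
noncomputable def splice (Z Y : ℤ → C) (f : ∀ i, Z i ⟶ Y i) (g : ∀ i, Y i ⟶ Z (i + 1))
    (h : ∀ i, f i ≫ g i = 0) : CochainComplex C ℤ :=
  CochainComplex.of Y (fun i => g i ≫ f (i + 1)) (fun i => by simp [reassoc_of% (h (i + 1))])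

theorem splice_d (Z Y : ℤ → C) (f : ∀ i, Z i ⟶ Y i) (g : ∀ i, Y i ⟶ Z (i + 1))
    (h : ∀ i, f i ≫ g i = 0) (i : ℤ) :
    (splice Z Y f g h).d i (i + 1) = g i ≫ f (i + 1) := by
  simp [splice]

theorem splice_exact {E : ExData C} (Z Y : ℤ → C) (f : ∀ i, Z i ⟶ Y i)
    (g : ∀ i, Y i ⟶ Z (i + 1)) (h : ∀ i, f i ≫ g i = 0) (ha : ∀ i, E.adm (f i) (g i)) :
    IsExactCpx E (splice Z Y f g h) :=
  ⟨Z, g, f, ha, splice_d Z Y f g h⟩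

/-- Chain maps from their components. -/
def mkHom {K L : CochainComplex C ℤ} (φ : ∀ i, K.X i ⟶ L.X i)
    (h : ∀ i, φ i ≫ L.d i (i + 1) = K.d i (i + 1) ≫ φ (i + 1)) : K ⟶ L where
  f := φ
  comm' i j hij := by
    obtain rfl : i + 1 = j := hij
    exact h i

/-- Homotopy equivalence from a strict retraction with a homotopy on one side. -/
theorem homotopyEquiv_of {K Y : CochainComplex C ℤ} (ψ : K ⟶ Y) (φ : Y ⟶ K)
    (h1 : ψ ≫ φ = 𝟙 K) (h : ∀ i, Y.X (i + 1) ⟶ Y.X i)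
    (hh : ∀ i, 𝟙 (Y.X (i + 1)) = φ.f (i + 1) ≫ ψ.f (i + 1) +
      (Y.d (i + 1) (i + 1 + 1) ≫ h (i + 1) + h i ≫ Y.d i (i + 1))) :
    Nonempty (HomotopyEquiv K Y) := by
  let H : ∀ i j, (ComplexShape.up ℤ).Rel j i → (Y.X i ⟶ Y.X j) :=
    fun i j hij => (Y.XIsoOfEq (show i = j + 1 from hij.symm)).hom ≫ h j
  have key : 𝟙 Y - φ ≫ ψ = Homotopy.nullHomotopicMap' H := by
    ext i
    obtain ⟨i, rfl⟩ : ∃ k : ℤ, i = k + 1 := ⟨i - 1, by ring⟩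
    rw [Homotopy.nullHomotopicMap'_f (c := ComplexShape.up ℤ) (k₂ := i) (k₁ := i + 1)
      (k₀ := i + 1 + 1) rfl rfl]
    have := hh i
    simp only [H, HomologicalComplex.sub_f_apply, HomologicalComplex.id_f,
      HomologicalComplex.comp_f, HomologicalComplex.XIsoOfEq_rfl, Iso.refl_hom, Category.id_comp]
    rw [this]; abel
  have ho : Homotopy (𝟙 Y - φ ≫ ψ) 0 := (Homotopy.ofEq key).trans (Homotopy.nullHomotopy' H)
  exact ⟨⟨ψ, φ, Homotopy.ofEq h1, ((Homotopy.equivSubZero).symm ho).symm⟩⟩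

/-- Chain maps to a spliced complex. -/
noncomputable def toSplice {Z Y : ℤ → C} {f : ∀ i, Z i ⟶ Y i} {g : ∀ i, Y i ⟶ Z (i + 1)}
    (h : ∀ i, f i ≫ g i = 0) {K : CochainComplex C ℤ} (φ : ∀ i, K.X i ⟶ Y i)
    (hφ : ∀ i, φ i ≫ g i ≫ f (i + 1) = K.d i (i + 1) ≫ φ (i + 1)) : K ⟶ splice Z Y f g h :=
  mkHom φ (fun i => by rw [splice_d]; exact hφ i)

/-- Chain maps from a spliced complex. -/
noncomputable def fromSplice {Z Y : ℤ → C} {f : ∀ i, Z i ⟶ Y i} {g : ∀ i, Y i ⟶ Z (i + 1)}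
    (h : ∀ i, f i ≫ g i = 0) {K : CochainComplex C ℤ} (φ : ∀ i, Y i ⟶ K.X i)
    (hφ : ∀ i, φ i ≫ K.d i (i + 1) = (g i ≫ f (i + 1)) ≫ φ (i + 1)) : splice Z Y f g h ⟶ K :=
  mkHom φ (fun i => by rw [splice_d]; exact hφ i)

theorem isZero_of_isIso {X Y : C} (u : X ⟶ Y) (hu : IsIso u) (h : IsZero Y) : IsZero X :=
  h.of_iso (asIso u)

theorem isZero_of_isIso' {X Y : C} (u : X ⟶ Y) (hu : IsIso u) (h : IsZero X) : IsZero Y :=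
  h.of_iso (asIso u).symm

/-- A strict retract of an exact complex is acyclic. -/
theorem acyclic_of_strict {E : ExData C} (hE : E.IsExact) {K L : CochainComplex C ℤ}
    (hL : IsExactCpx E L) (s : K ⟶ L) (r : L ⟶ K) (hsr : s ≫ r = 𝟙 K) : IsAcyclicCpx E K := by
  obtain ⟨W, p, j, ha, hd⟩ := hL
  have mj := fun i => adm_mono hE (ha i)
  have ep := fun i => adm_epi hE (ha i)
  have hjp := fun i => adm_comp hE (ha i)
  have srf : ∀ i, s.f i ≫ r.f i = 𝟙 _ := fun i => by
    rw [← HomologicalComplex.comp_f, hsr, HomologicalComplex.id_f]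
  have rc : ∀ i, r.f i ≫ K.d i (i + 1) = L.d i (i + 1) ≫ r.f (i + 1) := fun i => r.comm _ _
  have sc : ∀ i, s.f i ≫ L.d i (i + 1) = K.d i (i + 1) ≫ s.f (i + 1) := fun i => s.comm _ _
  -- the idempotent on cycles
  have hjd : ∀ i, j i ≫ L.d i (i + 1) = 0 := fun i => by rw [hd, reassoc_of% (hjp i), zero_comp]
  have hex : ∀ i, ∃ e : W i ⟶ W i, e ≫ j i = j i ≫ r.f i ≫ s.f i := fun i => by
    refine adm_lift hE (ha i) _ ?_
    rw [← cancel_mono (j (i + 1))]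
    simp only [Category.assoc, ← hd, sc]
    rw [reassoc_of% (rc i), reassoc_of% (hjd i)]
    simp
  choose e he using hex
  have hpe : ∀ i, p i ≫ e (i + 1) = r.f i ≫ s.f i ≫ p i := fun i => by
    rw [← cancel_mono (j (i + 1))]
    simp only [Category.assoc, ← hd, sc, he]
    rw [reassoc_of% (rc i), hd]
    simp
  have hee : ∀ i, e i ≫ e i = e i := fun i => by
    rw [← cancel_mono (j i)]
    simp only [Category.assoc, he]
    rw [reassoc_of% (he i), reassoc_of% (srf i)]
  choose Y f u g hY hf hu using fun i => hE.ex2b (j i) (p i) (ha i) (e (i + 1))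
  have hfg := fun i => adm_comp hE (hY i)
  have mf := fun i => adm_mono hE (hY i)
  have ext : ∀ i {T : C} (a b : T ⟶ Y i), a ≫ u i = b ≫ u i → a ≫ g i = b ≫ g i → a = b :=
    fun i T a b h1 h2 => pb_ext hE (hY i) (hf i) a b h1 h2
  choose ψ hψ1 hψ2 using fun i => pb_lift hE (ha i) (hY i) (hf i) (hu i) (s.f i) (s.f i ≫ p i)
    (by rw [Category.assoc, hpe, reassoc_of% (srf i)])
  choose σ hσ1 hσ2 using fun i => pb_lift hE (ha i) (hY i) (hf i) (hu i) (0 : W (i + 1) ⟶ _)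
    (𝟙 _ - e (i + 1)) (by simp [hee])
  have heσ : ∀ i, e (i + 1) ≫ σ i = 0 := fun i => ext i _ _ (by simp [hσ1]) (by simp [hσ2, hee])
  have hjr : ∀ i, j i ≫ r.f i ≫ ψ i = e i ≫ f i := fun i => ext i _ _
    (by simp [hψ1, hf, he]) (by
      simp only [Category.assoc, hψ2, hfg, comp_zero]
      rw [← hpe, reassoc_of% (hjp i), zero_comp])
  choose ρ hρ using fun i => adm_lift hE (hY i)
    (𝟙 _ - u i ≫ r.f i ≫ ψ i - g i ≫ σ i) (by
      simp only [Preadditive.sub_comp, Category.assoc, hψ2, hσ2, Preadditive.comp_sub,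
        Category.comp_id, Category.id_comp, ← hpe]
      rw [reassoc_of% (hu i), hee]; abel)
  have hfρ : ∀ i, f i ≫ ρ i = 𝟙 _ - e i := fun i => by
    rw [← cancel_mono (f i), Category.assoc, hρ]
    simp only [Preadditive.sub_comp, Preadditive.comp_sub, Category.comp_id, Category.id_comp]
    rw [reassoc_of% (hf i), hjr, reassoc_of% (hfg i)]
    simp
  have hρe : ∀ i, ρ i ≫ e i ≫ f i = 0 := fun i => by
    rw [← hjr, ← hf, Category.assoc, reassoc_of% (hρ i)]
    simp only [Preadditive.sub_comp, Category.assoc, Category.id_comp]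
    rw [reassoc_of% (hσ1 i), reassoc_of% (hψ1 i), reassoc_of% (srf i)]
    simp
  refine ⟨splice W Y f g hfg, splice_exact W Y f g hfg hY, ?_⟩
  let Ψ : K ⟶ splice W Y f g hfg := toSplice hfg ψ (fun i => by
    refine ext (i + 1) _ _ ?_ ?_
    · simp only [Category.assoc, hf, hψ1]
      rw [reassoc_of% (hψ2 i), ← hd, sc]
    · simp only [Category.assoc, hfg, hψ2, comp_zero]
      rw [← reassoc_of% (sc i), hd, Category.assoc, hjp, comp_zero, comp_zero])
  let Φ : splice W Y f g hfg ⟶ K := fromSplice hfg (fun i => u i ≫ r.f i) (fun i => by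
    rw [Category.assoc, rc, hd, Category.assoc, reassoc_of% (hu i), reassoc_of% (he (i + 1)),
      srf, Category.comp_id, Category.assoc, reassoc_of% (hf (i + 1))])
  refine homotopyEquiv_of Ψ Φ ?_ (fun i => ρ (i + 1) ≫ σ i) ?_
  · ext i
    change ψ i ≫ u i ≫ r.f i = 𝟙 _
    rw [reassoc_of% (hψ1 i), srf]
  · intro i
    rw [splice_d, splice_d]
    change 𝟙 (Y (i + 1)) = (u (i + 1) ≫ r.f (i + 1)) ≫ ψ (i + 1) + (_ + _)
    have h1 : (g (i + 1) ≫ f (i + 1 + 1)) ≫ ρ (i + 1 + 1) ≫ σ (i + 1) = g (i + 1) ≫ σ (i + 1) := by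
      rw [Category.assoc, reassoc_of% (hfρ (i + 1 + 1))]
      simp [heσ]
    have h2 : (ρ (i + 1) ≫ σ i) ≫ g i ≫ f (i + 1) = ρ (i + 1) ≫ f (i + 1) := by
      rw [Category.assoc, reassoc_of% (hσ2 i)]
      simp [hρe]
    have h12 := congrArg₂ (· + ·) h1 h2
    refine Eq.trans ?_ (congrArg (fun x => (u (i + 1) ≫ r.f (i + 1)) ≫ ψ (i + 1) + x) h12.symm)
    have h3 := hρ (i + 1)
    have h4 : 𝟙 (Y (i + 1)) = (u (i + 1) ≫ r.f (i + 1)) ≫ ψ (i + 1) +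
        (g (i + 1) ≫ σ (i + 1) + ρ (i + 1) ≫ f (i + 1)) := by
      rw [h3, Category.assoc]; abel
    exact h4

/-- A homotopy retract of an exact complex is acyclic. -/
theorem acyclic_of_retract {E : ExData C} (hE : E.IsExact) {K L : CochainComplex C ℤ}
    (hL : IsExactCpx E L) (s : K ⟶ L) (r : L ⟶ K) (h : Homotopy (s ≫ r) (𝟙 K)) :
    IsAcyclicCpx E K := by
  have := hasBinaryBiproducts hE
  obtain ⟨W, p, j, ha, hd⟩ := hL
  have rc : ∀ i, r.f i ≫ K.d i (i + 1) = L.d i (i + 1) ≫ r.f (i + 1) := fun i => r.comm _ _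
  have sc : ∀ i, s.f i ≫ L.d i (i + 1) = K.d i (i + 1) ≫ s.f (i + 1) := fun i => s.comm _ _
  let Z : ℤ → C := fun i => W i ⊞ K.X i
  let Y : ℤ → C := fun i => L.X i ⊞ (K.X i ⊞ K.X (i + 1))
  let f : ∀ i, Z i ⟶ Y i := fun i => biprod.map (j i) biprod.inl
  let g : ∀ i, Y i ⟶ Z (i + 1) := fun i => biprod.map (p i) biprod.snd
  have hA : ∀ i, E.adm (f i) (g i) := fun i => adm_biprod hE (ha i) (adm_inl_snd hE _ _)
  have hfg := fun i => adm_comp hE (hA i)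
  let α : ∀ i, K.X i ⟶ K.X i := fun i => prevD i h.hom
  have hα : ∀ i, α (i + 1) = h.hom (i + 1) i ≫ K.d i (i + 1) := fun i => prevD_eq _ rfl
  have hαd : ∀ i, α i ≫ K.d i (i + 1) = 0 := fun i => by
    obtain ⟨i, rfl⟩ : ∃ k : ℤ, i = k + 1 := ⟨i - 1, by ring⟩
    rw [hα]; simp
  have hc : ∀ i, s.f i ≫ r.f i = K.d i (i + 1) ≫ h.hom (i + 1) i + α i + 𝟙 _ := fun i => by
    have := h.comm i
    rw [dNext_eq h.hom (show (ComplexShape.up ℤ).Rel i (i + 1) from rfl)] at this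
    rw [HomologicalComplex.comp_f, HomologicalComplex.id_f] at this
    exact this
  let S : K ⟶ splice Z Y f g hfg :=
    toSplice hfg (fun i => biprod.lift (s.f i) (biprod.lift (𝟙 _) (K.d i (i + 1)))) (fun i => by
      refine biprod.hom_ext _ _ ?_ (biprod.hom_ext _ _ ?_ ?_)
      · simp [f, g, ← hd, sc]
      · simp [f, g]
      · simp [f, g])
  let R : splice Z Y f g hfg ⟶ K :=
    fromSplice hfg (fun i => biprod.desc (r.f i) (biprod.desc (- α i) (- h.hom (i + 1) i)))
      (fun i => by
      refine biprod.hom_ext' _ _ ?_ (biprod.hom_ext' _ _ ?_ ?_)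
      · simp [f, g, rc, hd]
      · simp [f, g, hαd]
      · simp [f, g, hα])
  refine acyclic_of_strict hE (splice_exact Z Y f g hfg hA) S R ?_
  ext i
  change biprod.lift (s.f i) (biprod.lift (𝟙 _) (K.d i (i + 1))) ≫
    biprod.desc (r.f i) (biprod.desc (- α i) (- h.hom (i + 1) i)) = 𝟙 _
  rw [biprod.lift_desc, biprod.lift_desc, hc]
  simp only [Category.id_comp, Preadditive.comp_neg]
  abel

theorem trunc_above {E : ExData C} (hE : E.IsExact) {K L : CochainComplex C ℤ}
    (hL : IsExactCpx E L) (hK : CpxBddAbove K) (s : K ⟶ L) :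
    ∃ (M : CochainComplex C ℤ), IsExactCpx E M ∧ CpxBddAbove M ∧ (CpxBddBelow L → CpxBddBelow M) ∧
      ∃ (s' : K ⟶ M) (u : M ⟶ L), s' ≫ u = s := by
  obtain ⟨W, p, j, ha, hd⟩ := hL
  obtain ⟨n, hn⟩ := hK
  have hjp := fun i => adm_comp hE (ha i)
  have sc : ∀ i, s.f i ≫ L.d i (i + 1) = K.d i (i + 1) ≫ s.f (i + 1) := fun i => s.comm _ _
  have h1 : ∀ i, ∃ (Z : C) (t : Z ⟶ W i), (i ≤ n + 1 → IsIso t) ∧ (n + 1 < i → IsZero Z) := by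
    intro i
    by_cases hi : i ≤ n + 1
    · exact ⟨W i, 𝟙 _, fun _ => inferInstance, fun h => by omega⟩
    · exact ⟨0, 0, fun h => by omega, fun _ => isZero_zero C⟩
  choose Z t ht hZ using h1
  have h2 : ∀ i, ∃ (Y : C) (f : Z i ⟶ Y) (g : Y ⟶ Z (i + 1)) (u : Y ⟶ L.X i),
      E.adm f g ∧ f ≫ u = t i ≫ j i ∧ u ≫ p i = g ≫ t (i + 1) ∧ (i ≤ n → IsIso u) ∧
        (n + 1 < i → IsZero Y) := by
    intro i
    by_cases hi : i ≤ n
    · have := ht i (by omega)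
      have := ht (i + 1) (by omega)
      refine ⟨L.X i, t i ≫ j i, p i ≫ inv (t (i + 1)), 𝟙 _, ?_, by simp, by simp,
        fun _ => inferInstance, fun h => by omega⟩
      exact hE.ex0.2 (j i) (p i) _ _ (asIso (t i)).symm (Iso.refl _) (asIso (t (i + 1))).symm (ha i)
        (by simp) (by simp)
    · have hz := hZ (i + 1) (by omega)
      exact ⟨Z i, 𝟙 _, 0, t i ≫ j i, adm_id_zero hE hz _, by simp, by simp [hjp],
        fun h => by omega, hZ i⟩
  choose Y f g u hA hf hu hI hY using h2
  have hfg := fun i => adm_comp hE (hA i)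
  have h3 : ∀ i, ∃ k : K.X i ⟶ Y i, k ≫ u i = s.f i := by
    intro i
    by_cases hi : i ≤ n
    · have := hI i hi
      exact ⟨s.f i ≫ inv (u i), by simp⟩
    · exact ⟨0, (hn i (by omega)).eq_of_src _ _⟩
  choose k hk using h3
  refine ⟨splice Z Y f g hfg, splice_exact Z Y f g hfg hA, ⟨n + 2, fun i hi => hY i (by omega)⟩,
    ?_, toSplice hfg k ?_, fromSplice hfg u ?_, ?_⟩
  · rintro ⟨m, hm⟩
    refine ⟨min m n, fun i hi => ?_⟩
    exact isZero_of_isIso (u i) (hI i (by omega)) (hm i (by omega))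
  · intro i
    by_cases hi : n ≤ i
    · exact (hn i hi).eq_of_src _ _
    · have := hI (i + 1) (by omega)
      refine (cancel_mono (u (i + 1))).1 ?_
      simp only [Category.assoc, hf, hk]
      rw [← reassoc_of% (hu i), reassoc_of% (hk i), ← hd, sc]
  · intro i
    rw [hd, Category.assoc, hf, reassoc_of% (hu i)]
  · ext i
    exact hk i

theorem trunc_below {E : ExData C} (hE : E.IsExact) {K L : CochainComplex C ℤ}
    (hL : IsExactCpx E L) (hK : CpxBddBelow K) (r : L ⟶ K) :
    ∃ (M : CochainComplex C ℤ), IsExactCpx E M ∧ CpxBddBelow M ∧ (CpxBddAbove L → CpxBddAbove M) ∧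
      ∃ (u : L ⟶ M) (r' : M ⟶ K), u ≫ r' = r := by
  obtain ⟨W, p, j, ha, hd⟩ := hL
  obtain ⟨n, hn⟩ := hK
  have hjp := fun i => adm_comp hE (ha i)
  have rc : ∀ i, r.f i ≫ K.d i (i + 1) = L.d i (i + 1) ≫ r.f (i + 1) := fun i => r.comm _ _
  have h1 : ∀ i, ∃ (Z : C) (t : W i ⟶ Z), (n ≤ i → IsIso t) ∧ (i < n → IsZero Z) := by
    intro i
    by_cases hi : n ≤ i
    · exact ⟨W i, 𝟙 _, fun _ => inferInstance, fun h => by omega⟩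
    · exact ⟨0, 0, fun h => by omega, fun _ => isZero_zero C⟩
  choose Z t ht hZ using h1
  have h2 : ∀ i, ∃ (Y : C) (f : Z i ⟶ Y) (g : Y ⟶ Z (i + 1)) (u : L.X i ⟶ Y),
      E.adm f g ∧ j i ≫ u = t i ≫ f ∧ u ≫ g = p i ≫ t (i + 1) ∧ (n ≤ i → IsIso u) ∧
        (i + 1 < n → IsZero Y) := by
    intro i
    by_cases hi : n ≤ i
    · have := ht i (by omega)
      have := ht (i + 1) (by omega)
      refine ⟨L.X i, inv (t i) ≫ j i, p i ≫ t (i + 1), 𝟙 _, ?_, by simp, by simp,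
        fun _ => inferInstance, fun h => by omega⟩
      exact hE.ex0.2 (j i) (p i) _ _ (asIso (t i)) (Iso.refl _) (asIso (t (i + 1))) (ha i)
        (by simp) (by simp)
    · have hz := hZ i (by omega)
      exact ⟨Z (i + 1), 0, 𝟙 _, p i ≫ t (i + 1), adm_zero_id hE hz _,
        by simp [reassoc_of% (hjp i)], by simp, fun h => by omega, hZ (i + 1)⟩
  choose Y f g u hA hf hu hI hY using h2
  have hfg := fun i => adm_comp hE (hA i)
  have h3 : ∀ i, ∃ k : Y i ⟶ K.X i, u i ≫ k = r.f i := by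
    intro i
    by_cases hi : n ≤ i
    · have := hI i hi
      exact ⟨inv (u i) ≫ r.f i, by simp⟩
    · exact ⟨0, (hn i (by omega)).eq_of_tgt _ _⟩
  choose k hk using h3
  have uc : ∀ i, u i ≫ g i ≫ f (i + 1) = L.d i (i + 1) ≫ u (i + 1) := fun i => by
    rw [hd, Category.assoc, hf, reassoc_of% (hu i)]
  refine ⟨splice Z Y f g hfg, splice_exact Z Y f g hfg hA, ⟨n - 2, fun i hi => hY i (by omega)⟩,
    ?_, toSplice hfg u ?_, fromSplice hfg k ?_, ?_⟩
  · rintro ⟨m, hm⟩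
    refine ⟨max m n, fun i hi => ?_⟩
    exact isZero_of_isIso' (u i) (hI i (by omega)) (hm i (by omega))
  · intro i
    exact uc i
  · intro i
    by_cases hi : i + 1 ≤ n
    · exact (hn (i + 1) hi).eq_of_tgt _ _
    · have := hI i (by omega)
      refine (cancel_epi (u i)).1 ?_
      rw [reassoc_of% (hk i), rc, ← hk (i + 1), ← reassoc_of% (uc i), Category.assoc]
  · ext i
    exact hk i

end ExAux

/-- For any exact category `E` and any boundedness condition `B` among
{bounded above, bounded below, bounded}, a `B`-bounded complex over `E` is acyclic if and
only if it is a direct summand, in the homotopy category, of a `B`-bounded exact complex. -/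
theorem stmt_5 (E : ExData C) (hE : E.IsExact)
    (B : CochainComplex C ℤ → Prop)
    (hB : B = CpxBddAbove (C := C) ∨ B = CpxBddBelow (C := C) ∨
      B = fun K => CpxBddAbove K ∧ CpxBddBelow K) :
    ∀ K : CochainComplex C ℤ, B K →
      (IsAcyclicCpx E K ↔
        ∃ (L : CochainComplex C ℤ), B L ∧ IsExactCpx E L ∧
          ∃ (s : K ⟶ L) (r : L ⟶ K), Nonempty (Homotopy (s ≫ r) (𝟙 K))) := by
  intro K hK
  constructor
  · rintro ⟨L, hL, ⟨e⟩⟩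
    have h := e.homotopyHomInvId
    rcases hB with rfl | rfl | rfl
    · obtain ⟨M, hM, hMa, -, s, u, hs⟩ := ExAux.trunc_above hE hL hK e.hom
      exact ⟨M, hMa, hM, s, u ≫ e.inv, ⟨(Homotopy.ofEq (by rw [← hs, Category.assoc])).trans h⟩⟩
    · obtain ⟨M, hM, hMb, -, u, r, hr⟩ := ExAux.trunc_below hE hL hK e.inv
      exact ⟨M, hMb, hM, e.hom ≫ u, r, ⟨(Homotopy.ofEq (by rw [← hr, Category.assoc])).trans h⟩⟩
    · obtain ⟨M, hM, hMa, -, s, u, hs⟩ := ExAux.trunc_above hE hL hK.1 e.hom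
      obtain ⟨N, hN, hNb, hNa, v, r, hr⟩ := ExAux.trunc_below hE hM hK.2 (u ≫ e.inv)
      exact ⟨N, ⟨hNa hMa, hNb⟩, hN, s ≫ v, r,
        ⟨(Homotopy.ofEq (by rw [Category.assoc, hr, ← hs, Category.assoc])).trans h⟩⟩
  · rintro ⟨L, -, hL, s, r, ⟨h⟩⟩
    exact ExAux.acyclic_of_retract hE hL s r h
end

section
/- Let D be a triangulated category, A ⊂ D a full subcategory, and M = ∪_m A^{*m} the minimal full subcategory containing A and closed under extensions. Then for every n ≥ 2, the following are equivalent: (a) every morphism X → Y[k] with 2 ≤ k ≤ n and X, Y ∈ M is a composition of a chain of morphisms Z_{i-1} → Z_i[1] with all Z_i ∈ M, Z_0 = X, Z_k = Y; (b) every morphism A → Y[k] with 2 ≤ k ≤ n, A ∈ A, Y ∈ M factors as A → Z[1] → Y[k] with Z ∈ M; (c) every such morphism factors as A → Z[k-1] → Y[k] with Z ∈ M. -/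
open CategoryTheory CategoryTheory.Limits CategoryTheory.Pretriangulated

universe v u

variable {D : Type u} [Category.{v} D] [Preadditive D] [HasZeroObject D]
  [HasShift D ℤ] [∀ n : ℤ, (CategoryTheory.shiftFunctor D n).Additive] [Pretriangulated D]

/-- The isomorphism class of an object. -/
def cls (A : D) : Set D := {Z | Nonempty (Z ≅ A)}

/-- The `*`-operation on classes of objects of a triangulated category: `Z ∈ S * T` iff
there is a distinguished triangle `X → Z → Y → X[1]` with `X ∈ S` and `Y ∈ T`. -/
def star (S T : Set D) : Set D :=
  {Z | ∃ X ∈ S, ∃ Y ∈ T, ∃ (f : X ⟶ Z) (g : Z ⟶ Y) (h : Y ⟶ X⟦(1 : ℤ)⟧),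
    Triangle.mk f g h ∈ distTriang D}

/-- The closure of a class of objects under isomorphism. -/
def isoCls (S : Set D) : Set D := {Z | ∃ X ∈ S, Nonempty (Z ≅ X)}

/-- Iterated extensions `S^{*m}`. -/
def starIter (S : Set D) : ℕ → Set D
  | 0 => isoCls S
  | (m + 1) => star S (starIter S m)

/-- The minimal full subcategory containing `S` and closed under extensions,
`M = ⋃ₘ S^{*m}`. -/
def Mcat (S : Set D) : Set D := {Z | ∃ m : ℕ, Z ∈ starIter S m}

/-- `Decomp M k φ` says that the degree-`k` morphism `φ : X ⟶ Y[k]` is the composition of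
a chain of `k` degree-one morphisms `Z_{i-1} ⟶ Z_i[1]` with all intermediate objects
`Z_1, …, Z_{k-1}` in `M`. -/
def Decomp (M : Set D) : (k : ℕ) → ∀ {X Y : D}, (X ⟶ Y⟦((k : ℕ) : ℤ)⟧) → Prop
  | 0, _, _, _ => False
  | 1, _, _, _ => True
  | (k + 2), X, Y, φ => ∃ Z ∈ M, ∃ (α : X ⟶ Z⟦(1 : ℤ)⟧) (β : Z ⟶ Y⟦((k + 1 : ℕ) : ℤ)⟧),
      Decomp M (k + 1) β ∧
      φ = α ≫ (CategoryTheory.shiftFunctor D (1 : ℤ)).map β ≫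
        (shiftFunctorAdd' D ((k + 1 : ℕ) : ℤ) (1 : ℤ) ((k + 2 : ℕ) : ℤ)
          (by push_cast; ring)).inv.app Y


/-! ### Elementary facts on distinguished triangles (no octahedral axiom is used) -/

section Aux

theorem dz12 {X Y Z : D} {f : X ⟶ Y} {g : Y ⟶ Z} {h : Z ⟶ X⟦(1 : ℤ)⟧}
    (H : Triangle.mk f g h ∈ distTriang D) : f ≫ g = 0 :=
  comp_distTriang_mor_zero₁₂ _ H

theorem dz23 {X Y Z : D} {f : X ⟶ Y} {g : Y ⟶ Z} {h : Z ⟶ X⟦(1 : ℤ)⟧}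
    (H : Triangle.mk f g h ∈ distTriang D) : g ≫ h = 0 :=
  comp_distTriang_mor_zero₂₃ _ H

theorem dz31 {X Y Z : D} {f : X ⟶ Y} {g : Y ⟶ Z} {h : Z ⟶ X⟦(1 : ℤ)⟧}
    (H : Triangle.mk f g h ∈ distTriang D) :
    h ≫ (CategoryTheory.shiftFunctor D (1 : ℤ)).map f = 0 :=
  comp_distTriang_mor_zero₃₁ _ H

theorem dy2 {X Y Z : D} {f : X ⟶ Y} {g : Y ⟶ Z} {h : Z ⟶ X⟦(1 : ℤ)⟧}
    (H : Triangle.mk f g h ∈ distTriang D) {T : D} (x : Y ⟶ T) (hx : f ≫ x = 0) :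
    ∃ y : Z ⟶ T, x = g ≫ y :=
  Triangle.yoneda_exact₂ _ H x hx

theorem dy3 {X Y Z : D} {f : X ⟶ Y} {g : Y ⟶ Z} {h : Z ⟶ X⟦(1 : ℤ)⟧}
    (H : Triangle.mk f g h ∈ distTriang D) {T : D} (x : Z ⟶ T) (hx : g ≫ x = 0) :
    ∃ y : X⟦(1 : ℤ)⟧ ⟶ T, x = h ≫ y :=
  Triangle.yoneda_exact₃ _ H x hx

theorem dc1 {X Y Z : D} {f : X ⟶ Y} {g : Y ⟶ Z} {h : Z ⟶ X⟦(1 : ℤ)⟧}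
    (H : Triangle.mk f g h ∈ distTriang D) {T : D} (x : T ⟶ X⟦(1 : ℤ)⟧)
    (hx : x ≫ (CategoryTheory.shiftFunctor D (1 : ℤ)).map f = 0) :
    ∃ y : T ⟶ Z, x = y ≫ h :=
  Triangle.coyoneda_exact₁ _ H x hx

theorem dc2 {X Y Z : D} {f : X ⟶ Y} {g : Y ⟶ Z} {h : Z ⟶ X⟦(1 : ℤ)⟧}
    (H : Triangle.mk f g h ∈ distTriang D) {T : D} (x : T ⟶ Y) (hx : x ≫ g = 0) :
    ∃ y : T ⟶ X, x = y ≫ f :=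
  Triangle.coyoneda_exact₂ _ H x hx

theorem dc3 {X Y Z : D} {f : X ⟶ Y} {g : Y ⟶ Z} {h : Z ⟶ X⟦(1 : ℤ)⟧}
    (H : Triangle.mk f g h ∈ distTriang D) {T : D} (x : T ⟶ Z) (hx : x ≫ h = 0) :
    ∃ y : T ⟶ Y, x = y ≫ g :=
  Triangle.coyoneda_exact₃ _ H x hx

theorem dm2 {X Y Z : D} {f : X ⟶ Y} {g : Y ⟶ Z} {h : Z ⟶ X⟦(1 : ℤ)⟧}
    (H : Triangle.mk f g h ∈ distTriang D) {P Q R : D} {k : P ⟶ Q} {l : Q ⟶ R}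
    {m : R ⟶ P⟦(1 : ℤ)⟧} (K : Triangle.mk k l m ∈ distTriang D) (a : X ⟶ P) (c : Z ⟶ R)
    (comm : h ≫ (CategoryTheory.shiftFunctor D (1 : ℤ)).map a = c ≫ m) :
    ∃ b : Y ⟶ Q, f ≫ b = a ≫ k ∧ g ≫ c = b ≫ l :=
  complete_distinguished_triangle_morphism₂ _ _ H K a c comm

theorem dm3 {X Y Z : D} {f : X ⟶ Y} {g : Y ⟶ Z} {h : Z ⟶ X⟦(1 : ℤ)⟧}
    (H : Triangle.mk f g h ∈ distTriang D) {P Q R : D} {k : P ⟶ Q} {l : Q ⟶ R}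
    {m : R ⟶ P⟦(1 : ℤ)⟧} (K : Triangle.mk k l m ∈ distTriang D) (a : X ⟶ P) (b : Y ⟶ Q)
    (comm : f ≫ b = a ≫ k) :
    ∃ c : Z ⟶ R, g ≫ c = b ≫ l ∧ h ≫ (CategoryTheory.shiftFunctor D (1 : ℤ)).map a = c ≫ m :=
  complete_distinguished_triangle_morphism _ _ H K a b comm

theorem dext {X Y Z : D} {f : X ⟶ Y} {g : Y ⟶ Z} {h : Z ⟶ X⟦(1 : ℤ)⟧}
    (H : Triangle.mk f g h ∈ distTriang D) {T : D} (z : X ⟶ T)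
    (hz : h ≫ (CategoryTheory.shiftFunctor D (1 : ℤ)).map z = 0) :
    ∃ x : Y ⟶ T, f ≫ x = z := by
  obtain ⟨b, hb, _⟩ := dm2 H (contractible_distinguished T) z 0 (by rw [hz, zero_comp])
  exact ⟨b, by rw [hb, Category.comp_id]⟩

/-- An endomorphism of the middle term compatible with the identities of the outer terms
is (explicitly) invertible. -/
theorem dinv {X Y Z : D} {f : X ⟶ Y} {g : Y ⟶ Z} {h : Z ⟶ X⟦(1 : ℤ)⟧}
    (H : Triangle.mk f g h ∈ distTriang D) (θ : Y ⟶ Y) (h1 : f ≫ θ = f) (h2 : θ ≫ g = g) :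
    ∃ θ' : Y ⟶ Y, θ ≫ θ' = 𝟙 Y := by
  obtain ⟨y, hy⟩ := dy2 H (θ - 𝟙 Y) (by simp [h1])
  refine ⟨𝟙 Y - (θ - 𝟙 Y), ?_⟩
  have e : (θ - 𝟙 Y) ≫ (θ - 𝟙 Y) = 0 := by
    nth_rewrite 2 [hy]
    rw [← Category.assoc, Preadditive.sub_comp, h2, Category.id_comp, sub_self, zero_comp]
  simp only [Preadditive.sub_comp, Preadditive.comp_sub, Category.id_comp,
    Category.comp_id] at e ⊢
  have e2 : θ ≫ θ = θ + θ - 𝟙 Y := by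
    rw [← sub_eq_zero, ← e]; abel
  rw [e2]; abel

/-! ### The category `M` up to retracts -/

theorem Mcat_base (𝒜 : Set D) {A : D} (hA : A ∈ 𝒜) : A ∈ Mcat 𝒜 :=
  ⟨0, A, hA, ⟨Iso.refl _⟩⟩

theorem Mcat_star (𝒜 : Set D) {A X Y : D} (hA : A ∈ 𝒜) (hY : Y ∈ Mcat 𝒜)
    {f : A ⟶ X} {g : X ⟶ Y} {h : Y ⟶ A⟦(1 : ℤ)⟧}
    (H : Triangle.mk f g h ∈ distTriang D) : X ∈ Mcat 𝒜 := by
  obtain ⟨m, hm⟩ := hY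
  exact ⟨m + 1, A, hA, Y, hm, f, g, h, H⟩

/-- Any two objects of `M` are complementary retracts of an object of `M`. -/
theorem Mcat_sum (𝒜 : Set D) {W : D} (hW : W ∈ Mcat 𝒜) (m : ℕ) : ∀ Z : D, Z ∈ starIter 𝒜 m →
    ∃ E ∈ Mcat 𝒜, ∃ (a : Z ⟶ E) (c : E ⟶ Z) (w : W ⟶ E) (s : E ⟶ W),
      a ≫ c = 𝟙 Z ∧ w ≫ s = 𝟙 W ∧ a ≫ s = 0 ∧ w ≫ c = 0 := by
  induction m with
  | zero =>
    rintro Z ⟨B, hB, ⟨e⟩⟩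
    refine ⟨B ⊞ W, Mcat_star 𝒜 hB hW (binaryBiproductTriangle_distinguished B W),
      e.hom ≫ biprod.inl, biprod.fst ≫ e.inv, biprod.inr, biprod.snd, ?_, ?_, ?_, ?_⟩ <;> simp
  | succ m ih =>
    rintro Z ⟨B, hB, Z', hZ', f, g, h, H⟩
    obtain ⟨E', hE', a', c', w', s', h1, h2, h3, h4⟩ := ih Z' hZ'
    obtain ⟨E, f', g', H'⟩ := distinguished_cocone_triangle₂ (c' ≫ h)
    obtain ⟨a, ha1, ha2⟩ := dm2 H H' (𝟙 B) a' (by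
      rw [← Category.assoc, h1]; simp)
    obtain ⟨c, hc1, hc2⟩ := dm2 H' H (𝟙 B) c' (by simp)
    obtain ⟨w, hw⟩ := dc3 H' w' (by rw [← Category.assoc, h4, zero_comp])
    obtain ⟨θ, hθ⟩ := dinv H (a ≫ c) (by
      rw [← Category.assoc, ha1, Category.id_comp, hc1, Category.id_comp]) (by
      rw [Category.assoc, ← hc2, ← Category.assoc, ← ha2, Category.assoc, h1,
        Category.comp_id])
    have has : a ≫ g' ≫ s' = 0 := by
      rw [← Category.assoc, ← ha2, Category.assoc, h3, comp_zero]
    have hws : w ≫ g' ≫ s' = 𝟙 W := by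
      rw [← Category.assoc, ← hw, h2]
    have hac : a ≫ c ≫ θ = 𝟙 Z := by rw [← Category.assoc, hθ]
    refine ⟨E, Mcat_star 𝒜 hB hE' H', a, c ≫ θ - (g' ≫ s') ≫ w ≫ c ≫ θ, w, g' ≫ s',
      ?_, hws, has, ?_⟩
    · rw [Preadditive.comp_sub, hac, ← Category.assoc, has, zero_comp, sub_zero]
    · rw [Preadditive.comp_sub, ← Category.assoc w (g' ≫ s'), hws, Category.id_comp, sub_self]

/-- Morphisms factoring through an object of `M`. -/
def FacM (𝒜 : Set D) {X Y : D} (φ : X ⟶ Y) : Prop :=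
  ∃ W ∈ Mcat 𝒜, ∃ (a : X ⟶ W) (b : W ⟶ Y), φ = a ≫ b

/-- Retracts of objects of `M`. -/
def RetM (𝒜 : Set D) (X : D) : Prop := FacM 𝒜 (𝟙 X)

theorem FacM.pre {𝒜 : Set D} {X Y Z : D} (x : X ⟶ Y) {φ : Y ⟶ Z} (h : FacM 𝒜 φ) :
    FacM 𝒜 (x ≫ φ) := by
  obtain ⟨W, hW, a, b, rfl⟩ := h
  exact ⟨W, hW, x ≫ a, b, by simp⟩

theorem FacM.post {𝒜 : Set D} {X Y Z : D} {φ : X ⟶ Y} (h : FacM 𝒜 φ) (y : Y ⟶ Z) :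
    FacM 𝒜 (φ ≫ y) := by
  obtain ⟨W, hW, a, b, rfl⟩ := h
  exact ⟨W, hW, a, b ≫ y, by simp⟩

theorem FacM.add {𝒜 : Set D} {X Y : D} {φ ψ : X ⟶ Y} (h : FacM 𝒜 φ) (h' : FacM 𝒜 ψ) :
    FacM 𝒜 (φ + ψ) := by
  obtain ⟨W, ⟨m, hW⟩, a, b, rfl⟩ := h
  obtain ⟨W', hW', a', b', rfl⟩ := h'
  obtain ⟨E, hE, i, r, i', r', h1, h2, h3, h4⟩ := Mcat_sum 𝒜 hW' m W hW
  refine ⟨E, hE, a ≫ i + a' ≫ i', r ≫ b + r' ≫ b', ?_⟩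
  simp only [Preadditive.add_comp, Preadditive.comp_add, Category.assoc, reassoc_of% h1,
    reassoc_of% h2, reassoc_of% h3, reassoc_of% h4]
  simp

theorem RetM.fac {𝒜 : Set D} {X Y W : D} (hW : RetM 𝒜 W) (a : X ⟶ W) (b : W ⟶ Y) :
    FacM 𝒜 (a ≫ b) := by
  have := (FacM.pre a hW).post b
  simpa using this

theorem RetM_of_mem {𝒜 : Set D} {X : D} (h : X ∈ Mcat 𝒜) : RetM 𝒜 X :=
  ⟨X, h, 𝟙 X, 𝟙 X, by simp⟩

theorem RetM_iso {𝒜 : Set D} {X Y : D} (e : X ≅ Y) (h : RetM 𝒜 X) : RetM 𝒜 Y := by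
  have := h.fac e.inv e.hom
  rwa [e.inv_hom_id] at this

/-- Replacing the outer terms of an extension by larger objects. -/
theorem RetM_of_outer {𝒜 : Set D} {X Y Z : D} {f : X ⟶ Y} {g : Y ⟶ Z} {h : Z ⟶ X⟦(1 : ℤ)⟧}
    (H : Triangle.mk f g h ∈ distTriang D) {X' Z' : D} (i : X ⟶ X') (r : X' ⟶ X)
    (hir : i ≫ r = 𝟙 X) (j : Z ⟶ Z') (s : Z' ⟶ Z) (hjs : j ≫ s = 𝟙 Z)
    (hE : ∀ (E : D) (f' : X' ⟶ E) (g' : E ⟶ Z') (h' : Z' ⟶ X'⟦(1 : ℤ)⟧),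
      Triangle.mk f' g' h' ∈ distTriang D → RetM 𝒜 E) : RetM 𝒜 Y := by
  obtain ⟨E, f', g', H'⟩ := distinguished_cocone_triangle₂
    (s ≫ h ≫ (CategoryTheory.shiftFunctor D (1 : ℤ)).map i)
  obtain ⟨a, ha1, ha2⟩ := dm2 H H' i j (by rw [← Category.assoc j, hjs, Category.id_comp])
  obtain ⟨c, hc1, hc2⟩ := dm2 H' H r s (by
    rw [Category.assoc, Category.assoc, ← Functor.map_comp, hir]; simp)
  obtain ⟨θ, hθ⟩ := dinv H (a ≫ c) (by
      rw [← Category.assoc, ha1, Category.assoc, hc1, ← Category.assoc, hir,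
        Category.id_comp]) (by
      rw [Category.assoc, ← hc2, ← Category.assoc, ← ha2, Category.assoc, hjs,
        Category.comp_id])
  have := (hE E f' g' _ H').fac a (c ≫ θ)
  rwa [← Category.assoc, hθ] at this

/-- A weak form of the octahedral axiom, valid up to retracts in any pretriangulated
category. -/
theorem weak_octahedron {𝒜 : Set D} {B Z₁ P U Z₂ C : D}
    {f₁ : B ⟶ Z₁} {g₁ : Z₁ ⟶ P} {ε : P ⟶ B⟦(1 : ℤ)⟧}
    (T1 : Triangle.mk f₁ g₁ ε ∈ distTriang D)
    {i : Z₁ ⟶ U} {j : U ⟶ Z₂} {d : Z₂ ⟶ Z₁⟦(1 : ℤ)⟧}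
    (T2 : Triangle.mk i j d ∈ distTriang D)
    {m : U ⟶ C} {γ : C ⟶ B⟦(1 : ℤ)⟧}
    (T3 : Triangle.mk (f₁ ≫ i) m γ ∈ distTriang D)
    (hP : RetM 𝒜 P) (hZ₂ : RetM 𝒜 Z₂)
    (hext : ∀ (E : D) (f' : P ⟶ E) (g' : E ⟶ Z₂) (h' : Z₂ ⟶ P⟦(1 : ℤ)⟧),
      Triangle.mk f' g' h' ∈ distTriang D → RetM 𝒜 E) : RetM 𝒜 C := by
  obtain ⟨U₁, k, j₁, T4⟩ := distinguished_cocone_triangle₂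
    (d ≫ (CategoryTheory.shiftFunctor D (1 : ℤ)).map g₁)
  have hU₁ := hext U₁ k j₁ _ T4
  obtain ⟨q, hq1, hq2⟩ := dm2 T2 T4 g₁ (𝟙 Z₂) (by simp)
  obtain ⟨t, ht⟩ := dy2 T3 q (by
    rw [Category.assoc, hq1, ← Category.assoc, dz12 T1, zero_comp])
  obtain ⟨π, hπ1, hπ2⟩ := dm3 T3 T2 f₁ (𝟙 U) (by simp)
  rw [Category.id_comp] at hπ1
  obtain ⟨t', ht'⟩ := dc3 T4 π (by
    rw [← Category.assoc, ← hπ2, Category.assoc, ← Functor.map_comp, dz12 T1,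
      Functor.map_zero, comp_zero])
  have T1r : Triangle.mk ε (-(CategoryTheory.shiftFunctor D (1 : ℤ)).map f₁)
      (-(CategoryTheory.shiftFunctor D (1 : ℤ)).map g₁) ∈ distTriang D :=
    rot_of_distTriang _ (rot_of_distTriang _ T1)
  obtain ⟨e, he1, he2⟩ := dm2 T4 T1r (𝟙 P) (-d) (by simp)
  have he3 : j₁ ≫ d = e ≫ (CategoryTheory.shiftFunctor D (1 : ℤ)).map f₁ := by
    simpa using he2
  obtain ⟨τ, hτ⟩ := dc1 T1 (γ - t' ≫ e) (by
    rw [Preadditive.sub_comp, hπ2, Category.assoc, ← he3, ← Category.assoc, ← ht', sub_self])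
  obtain ⟨z, hz⟩ := dy2 T1 (i ≫ m) (by rw [← Category.assoc]; exact dz12 T3)
  obtain ⟨x, hx⟩ := dext T4 z (by
    rw [Category.assoc, ← Functor.map_comp, ← hz, Functor.map_comp, ← Category.assoc,
      dz31 T2, zero_comp])
  obtain ⟨y, hy⟩ := dy2 T2 (m ≫ (𝟙 C - t ≫ x)) (by
    rw [Preadditive.comp_sub, Preadditive.comp_sub, Category.comp_id, ← Category.assoc m,
      ← ht, ← Category.assoc i, hq1, Category.assoc, hx, hz, sub_self])
  obtain ⟨u, hu⟩ := dy3 T3 (𝟙 C - t ≫ x - π ≫ y) (by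
    rw [Preadditive.comp_sub, hy, ← Category.assoc, hπ1, sub_self])
  have key : 𝟙 C = t ≫ x + π ≫ y + (t' ≫ (e ≫ u) + τ ≫ (ε ≫ u)) := by
    rw [← Category.assoc τ, ← hτ, Preadditive.sub_comp, ← hu, Category.assoc]
    abel
  unfold RetM
  rw [key]
  exact ((hU₁.fac _ _).add (hZ₂.fac _ _)).add ((hU₁.fac _ _).add (hP.fac _ _))

theorem RetM_base_star {𝒜 : Set D} {B U Z : D} (hB : B ∈ 𝒜) (hZ : RetM 𝒜 Z)
    {f : B ⟶ U} {g : U ⟶ Z} {h : Z ⟶ B⟦(1 : ℤ)⟧}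
    (H : Triangle.mk f g h ∈ distTriang D) : RetM 𝒜 U := by
  obtain ⟨W, hW, j, s, hjs⟩ := hZ
  exact RetM_of_outer H (𝟙 B) (𝟙 B) (by simp) j s hjs.symm
    (fun E f' g' h' H' => RetM_of_mem (Mcat_star 𝒜 hB hW H'))

theorem RetM_ext_aux {𝒜 : Set D} {Z₂ : D} (hZ₂ : RetM 𝒜 Z₂) (m : ℕ) :
    ∀ Z₁ ∈ starIter 𝒜 m, ∀ (U : D) (f : Z₁ ⟶ U) (g : U ⟶ Z₂) (h : Z₂ ⟶ Z₁⟦(1 : ℤ)⟧),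
      Triangle.mk f g h ∈ distTriang D → RetM 𝒜 U := by
  induction m with
  | zero =>
    rintro Z₁ ⟨B, hB, ⟨e⟩⟩ U f g h H
    exact RetM_of_outer H e.hom e.inv e.hom_inv_id (𝟙 _) (𝟙 _) (by simp)
      (fun E f' g' h' H' => RetM_base_star hB hZ₂ H')
  | succ m ih =>
    rintro Z₁ ⟨B, hB, P, hP, f₁, g₁, ε, T1⟩ U f g h H
    obtain ⟨C, p, γ, T3⟩ := distinguished_cocone_triangle (f₁ ≫ f)
    exact RetM_base_star hB
      (weak_octahedron T1 H T3 (RetM_of_mem ⟨m, hP⟩) hZ₂ (ih P hP)) T3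

/-- The class of retracts of objects of `M` is closed under extensions. -/
theorem RetM_ext {𝒜 : Set D} {Z₁ U Z₂ : D} (hZ₁ : RetM 𝒜 Z₁) (hZ₂ : RetM 𝒜 Z₂)
    {f : Z₁ ⟶ U} {g : U ⟶ Z₂} {h : Z₂ ⟶ Z₁⟦(1 : ℤ)⟧}
    (H : Triangle.mk f g h ∈ distTriang D) : RetM 𝒜 U := by
  obtain ⟨W, ⟨m, hW⟩, i, r, hir⟩ := hZ₁
  exact RetM_of_outer H i r hir.symm (𝟙 _) (𝟙 _) (by simp) (RetM_ext_aux hZ₂ m W hW)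

/-- `T` is good if all morphisms `T ⟶ Y[1]`, with `Y ∈ M`, factor through `M`. -/
def Good (𝒜 : Set D) (T : D) : Prop :=
  ∀ Y ∈ Mcat 𝒜, ∀ φ : T ⟶ Y⟦(1 : ℤ)⟧, FacM 𝒜 φ

theorem Good.ret {𝒜 : Set D} {T : D} (hT : Good 𝒜 T) {Y : D} (hY : RetM 𝒜 Y)
    (φ : T ⟶ Y⟦(1 : ℤ)⟧) : FacM 𝒜 φ := by
  obtain ⟨W, hW, i, r, hir⟩ := hY
  have h := (hT W hW (φ ≫ (CategoryTheory.shiftFunctor D (1 : ℤ)).map i)).post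
    ((CategoryTheory.shiftFunctor D (1 : ℤ)).map r)
  rwa [Category.assoc, ← Functor.map_comp, ← hir, CategoryTheory.Functor.map_id, Category.comp_id] at h

theorem Good.ext {𝒜 : Set D} {A X X' : D} {f : A ⟶ X} {g : X ⟶ X'} {h : X' ⟶ A⟦(1 : ℤ)⟧}
    (H : Triangle.mk f g h ∈ distTriang D) (hA : Good 𝒜 A) (hX' : Good 𝒜 X') :
    Good 𝒜 X := by
  intro Y hY φ
  obtain ⟨Z₁, hZ₁, a, b, hab⟩ := hA Y hY (f ≫ φ)
  obtain ⟨V, v, z, TV⟩ := distinguished_cocone_triangle₂ b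
  have hV : RetM 𝒜 V := RetM_ext (RetM_of_mem hY) (RetM_of_mem hZ₁) TV
  obtain ⟨ψ, hψ⟩ := dy2 H (φ ≫ (CategoryTheory.shiftFunctor D (1 : ℤ)).map v) (by
    rw [← Category.assoc, hab, Category.assoc, dz31 TV, comp_zero])
  obtain ⟨Z₂, hZ₂, a₂, c, hac⟩ := hX'.ret hV ψ
  obtain ⟨V₂, w, z₂, TV₂⟩ := distinguished_cocone_triangle₂ c
  obtain ⟨C, p, γ, TC⟩ := distinguished_cocone_triangle (v ≫ w)
  have hC : RetM 𝒜 C := weak_octahedron TV TV₂ TC (RetM_of_mem hZ₁) (RetM_of_mem hZ₂)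
    (fun E f' g' h' H' => RetM_ext (RetM_of_mem hZ₁) (RetM_of_mem hZ₂) H')
  obtain ⟨x, hx⟩ := dc1 TC φ (by
    rw [Functor.map_comp, ← Category.assoc, hψ, hac, Category.assoc, Category.assoc,
      dz31 TV₂, comp_zero, comp_zero])
  rw [hx]
  exact hC.fac x γ

/-! ### Shifts -/

/-- Morphisms factoring through `Z[j]` with `Z` in `M`. -/
def FacS (𝒜 : Set D) (j : ℤ) {X Y : D} (φ : X ⟶ Y) : Prop :=
  ∃ Z ∈ Mcat 𝒜, ∃ (α : X ⟶ Z⟦j⟧) (β : Z⟦j⟧ ⟶ Y), φ = α ≫ β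

theorem good_of_facS {𝒜 : Set D} {j k : ℤ} (hjk : 1 + j = k) {X : D}
    (hX : ∀ Y ∈ Mcat 𝒜, ∀ φ : X ⟶ Y⟦k⟧, FacS 𝒜 j φ) : Good 𝒜 (X⟦(-j)⟧) := by
  intro Y hY φ
  let e := (shiftFunctorCompIsoId D (-j) j (neg_add_cancel j)).app X
  let s := (shiftFunctorAdd' D 1 j k hjk).app Y
  obtain ⟨Z, hZ, α, β, h⟩ := hX Y hY
    (e.inv ≫ (CategoryTheory.shiftFunctor D j).map φ ≫ s.inv)
  obtain ⟨α', hα⟩ := (CategoryTheory.shiftFunctor D j).map_surjective (e.hom ≫ α)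
  obtain ⟨β', hβ⟩ := (CategoryTheory.shiftFunctor D j).map_surjective (β ≫ s.hom)
  refine ⟨Z, hZ, α', β', (CategoryTheory.shiftFunctor D j).map_injective ?_⟩
  rw [Functor.map_comp, hα, hβ, Category.assoc, ← Category.assoc α, ← h]
  simp

theorem facS_of_good {𝒜 : Set D} {j k : ℤ} (hjk : 1 + j = k) {X : D}
    (hX : Good 𝒜 (X⟦(-j)⟧)) : ∀ Y ∈ Mcat 𝒜, ∀ φ : X ⟶ Y⟦k⟧, FacS 𝒜 j φ := by
  intro Y hY φ
  let e := (shiftFunctorCompIsoId D (-j) j (neg_add_cancel j)).app X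
  let s := (shiftFunctorAdd' D 1 j k hjk).app Y
  obtain ⟨ψ, hψ⟩ := (CategoryTheory.shiftFunctor D j).map_surjective (e.hom ≫ φ ≫ s.hom)
  obtain ⟨Z, hZ, α, β, h⟩ := hX Y hY ψ
  refine ⟨Z, hZ, e.inv ≫ (CategoryTheory.shiftFunctor D j).map α,
    (CategoryTheory.shiftFunctor D j).map β ≫ s.inv, ?_⟩
  rw [Category.assoc, ← Category.assoc _ _ s.inv, ← Functor.map_comp, ← h, hψ]
  simp

theorem good_iso {𝒜 : Set D} {X Y : D} (e : X ≅ Y) (h : Good 𝒜 X) : Good 𝒜 Y := by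
  intro Z hZ φ
  have := FacM.pre e.inv (h Z hZ (e.hom ≫ φ))
  simpa using this

theorem good_starIter {𝒜 : Set D} {j : ℤ} (h𝒜 : ∀ A ∈ 𝒜, Good 𝒜 (A⟦j⟧)) (m : ℕ) :
    ∀ X ∈ starIter 𝒜 m, Good 𝒜 (X⟦j⟧) := by
  induction m with
  | zero =>
    rintro X ⟨A, hA, ⟨e⟩⟩
    exact good_iso ((CategoryTheory.shiftFunctor D j).mapIso e.symm) (h𝒜 A hA)
  | succ m ih =>
    rintro X ⟨A, hA, X', hX', f, g, h, H⟩
    exact Good.ext (Triangle.shift_distinguished _ H j) (h𝒜 A hA) (ih X' hX')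

/-- Condition (c) extends from `𝒜` to `M`. -/
theorem facS_M {𝒜 : Set D} {j k : ℤ} (hjk : 1 + j = k)
    (h : ∀ A ∈ 𝒜, ∀ Y ∈ Mcat 𝒜, ∀ φ : A ⟶ Y⟦k⟧, FacS 𝒜 j φ) :
    ∀ X ∈ Mcat 𝒜, ∀ Y ∈ Mcat 𝒜, ∀ φ : X ⟶ Y⟦k⟧, FacS 𝒜 j φ := by
  rintro X ⟨m, hX⟩
  exact facS_of_good hjk
    (good_starIter (fun A hA => good_of_facS hjk (h A hA)) m X hX)

/-- (b) implies (c). -/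
theorem b_imp_c {𝒜 : Set D} {n : ℕ}
    (hb : ∀ k : ℕ, 2 ≤ k → k ≤ n → ∀ A ∈ 𝒜, ∀ Y ∈ Mcat 𝒜,
      ∀ φ : A ⟶ Y⟦((k : ℕ) : ℤ)⟧, FacS 𝒜 1 φ) (k : ℕ) (hk : 2 ≤ k) :
    k ≤ n → ∀ A ∈ 𝒜, ∀ Y ∈ Mcat 𝒜,
      ∀ φ : A ⟶ Y⟦((k : ℕ) : ℤ)⟧, FacS 𝒜 ((k : ℤ) - 1) φ := by
  induction k, hk using Nat.le_induction with
  | base =>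
    intro hkn A hA Y hY φ
    exact hb 2 le_rfl hkn A hA Y hY φ
  | succ k hk ih =>
    intro hkn A hA Y hY φ
    have hM := facS_M (j := (k : ℤ) - 1) (k := (k : ℤ)) (by ring) (ih (by omega))
    obtain ⟨Z, hZ, α, β, rfl⟩ := hb (k + 1) (by omega) hkn A hA Y hY φ
    let s := (shiftFunctorAdd' D (k : ℤ) 1 ((k + 1 : ℕ) : ℤ) (by push_cast; ring)).app Y
    obtain ⟨β', hβ⟩ := (CategoryTheory.shiftFunctor D (1 : ℤ)).map_surjective (β ≫ s.hom)
    obtain ⟨W, hW, a, b, hab⟩ := hM Z hZ Y hY β'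
    let r := (shiftFunctorAdd' D ((k : ℤ) - 1) 1 (((k + 1 : ℕ) : ℤ) - 1)
      (by push_cast; ring)).app W
    refine ⟨W, hW, α ≫ (CategoryTheory.shiftFunctor D (1 : ℤ)).map a ≫ r.inv,
      r.hom ≫ (CategoryTheory.shiftFunctor D (1 : ℤ)).map b ≫ s.inv, ?_⟩
    have h2 : β = (CategoryTheory.shiftFunctor D (1 : ℤ)).map β' ≫ s.inv := by
      rw [hβ]; simp
    rw [h2, hab, Functor.map_comp]
    simp only [Category.assoc, Iso.inv_hom_id_assoc]

/-- (c) implies (b) for all objects of `M`. -/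
theorem c_imp_b {𝒜 : Set D} {n : ℕ}
    (hc : ∀ k : ℕ, 2 ≤ k → k ≤ n → ∀ A ∈ 𝒜, ∀ Y ∈ Mcat 𝒜,
      ∀ φ : A ⟶ Y⟦((k : ℕ) : ℤ)⟧, FacS 𝒜 ((k : ℤ) - 1) φ) (k : ℕ) (hk : 2 ≤ k) :
    k ≤ n → ∀ X ∈ Mcat 𝒜, ∀ Y ∈ Mcat 𝒜, ∀ l : ℤ, l = (k : ℤ) →
      ∀ φ : X ⟶ Y⟦l⟧, FacS 𝒜 1 φ := by
  induction k, hk using Nat.le_induction with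
  | base =>
    rintro hkn X hX Y hY l rfl φ
    exact facS_M (by norm_num) (hc 2 le_rfl hkn) X hX Y hY φ
  | succ k hk ih =>
    rintro hkn X hX Y hY l rfl φ
    obtain ⟨Z, hZ, α, β, rfl⟩ := facS_M (j := ((k + 1 : ℕ) : ℤ) - 1) (by ring)
      (hc (k + 1) (by omega) hkn) X hX Y hY φ
    obtain ⟨W, hW, a, b, rfl⟩ := ih (by omega) X hX Z hZ _ (by push_cast; ring) α
    exact ⟨W, hW, a, b ≫ β, by simp⟩

/-- (b) for all objects of `M` implies (a). -/
theorem b_imp_a {𝒜 : Set D} {n : ℕ}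
    (hb : ∀ k : ℕ, 2 ≤ k → k ≤ n → ∀ X ∈ Mcat 𝒜, ∀ Y ∈ Mcat 𝒜,
      ∀ φ : X ⟶ Y⟦((k : ℕ) : ℤ)⟧, FacS 𝒜 1 φ) (k : ℕ) :
    k + 1 ≤ n → ∀ X ∈ Mcat 𝒜, ∀ Y ∈ Mcat 𝒜, ∀ φ : X ⟶ Y⟦((k + 1 : ℕ) : ℤ)⟧,
      Decomp (Mcat 𝒜) (k + 1) φ := by
  induction k with
  | zero =>
    intro _ X _ Y _ φ
    simp [Decomp]
  | succ k ih =>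
    intro hkn X hX Y hY φ
    obtain ⟨Z, hZ, α, β, rfl⟩ := hb (k + 2) (by omega) hkn X hX Y hY φ
    let s := (shiftFunctorAdd' D ((k + 1 : ℕ) : ℤ) 1 ((k + 2 : ℕ) : ℤ)
      (by push_cast; ring)).app Y
    obtain ⟨β', hβ⟩ := (CategoryTheory.shiftFunctor D (1 : ℤ)).map_surjective (β ≫ s.hom)
    refine ⟨Z, hZ, α, β', ih (by omega) Z hZ Y hY β', ?_⟩
    rw [hβ]
    change α ≫ β = α ≫ (β ≫ s.hom) ≫ s.inv
    simp

end Aux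

/-- Let `𝒜 ⊆ D` be a full subcategory and `M = ⋃ₘ 𝒜^{*m}` the minimal full subcategory
containing `𝒜` and closed under extensions.  For every `n ≥ 2` the following are
equivalent: (a) every morphism `X ⟶ Y[k]` with `2 ≤ k ≤ n`, `X, Y ∈ M`, is a composition
of a chain of degree-one morphisms through `M`; (b) every morphism `A ⟶ Y[k]` with
`2 ≤ k ≤ n`, `A ∈ 𝒜`, `Y ∈ M`, factors as `A ⟶ Z[1] ⟶ Y[k]` with `Z ∈ M`; (c) every such
morphism factors as `A ⟶ Z[k-1] ⟶ Y[k]` with `Z ∈ M`. -/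
theorem stmt_15 (𝒜 : Set D) (n : ℕ) (hn : 2 ≤ n) :
    ((∀ k : ℕ, 2 ≤ k → k ≤ n → ∀ X ∈ Mcat 𝒜, ∀ Y ∈ Mcat 𝒜,
        ∀ φ : X ⟶ Y⟦((k : ℕ) : ℤ)⟧, Decomp (Mcat 𝒜) k φ) ↔
      (∀ k : ℕ, 2 ≤ k → k ≤ n → ∀ A ∈ 𝒜, ∀ Y ∈ Mcat 𝒜,
        ∀ φ : A ⟶ Y⟦((k : ℕ) : ℤ)⟧, ∃ Z ∈ Mcat 𝒜,
          ∃ (α : A ⟶ Z⟦(1 : ℤ)⟧) (β : Z⟦(1 : ℤ)⟧ ⟶ Y⟦((k : ℕ) : ℤ)⟧), φ = α ≫ β)) ∧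
    ((∀ k : ℕ, 2 ≤ k → k ≤ n → ∀ A ∈ 𝒜, ∀ Y ∈ Mcat 𝒜,
        ∀ φ : A ⟶ Y⟦((k : ℕ) : ℤ)⟧, ∃ Z ∈ Mcat 𝒜,
          ∃ (α : A ⟶ Z⟦(1 : ℤ)⟧) (β : Z⟦(1 : ℤ)⟧ ⟶ Y⟦((k : ℕ) : ℤ)⟧), φ = α ≫ β) ↔
      (∀ k : ℕ, 2 ≤ k → k ≤ n → ∀ A ∈ 𝒜, ∀ Y ∈ Mcat 𝒜,
        ∀ φ : A ⟶ Y⟦((k : ℕ) : ℤ)⟧, ∃ Z ∈ Mcat 𝒜,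
          ∃ (α : A ⟶ Z⟦((k : ℤ) - 1)⟧) (β : Z⟦((k : ℤ) - 1)⟧ ⟶ Y⟦((k : ℕ) : ℤ)⟧),
            φ = α ≫ β)) := by
  have hbc := fun hb => b_imp_c (𝒜 := 𝒜) (n := n) hb
  have hca : (∀ k : ℕ, 2 ≤ k → k ≤ n → ∀ A ∈ 𝒜, ∀ Y ∈ Mcat 𝒜,
      ∀ φ : A ⟶ Y⟦((k : ℕ) : ℤ)⟧, FacS 𝒜 ((k : ℤ) - 1) φ) →
      ∀ k : ℕ, 2 ≤ k → k ≤ n → ∀ X ∈ Mcat 𝒜, ∀ Y ∈ Mcat 𝒜,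
        ∀ φ : X ⟶ Y⟦((k : ℕ) : ℤ)⟧, Decomp (Mcat 𝒜) k φ := by
    intro hc k hk hkn
    obtain ⟨k, rfl⟩ : ∃ l, k = l + 1 := ⟨k - 1, by omega⟩
    exact b_imp_a (fun k hk hkn X hX Y hY φ => c_imp_b hc k hk hkn X hX Y hY _ rfl φ) k hkn
  refine ⟨⟨?_, fun hb => hca (hbc hb)⟩, ⟨hbc, fun hc k hk hkn A hA Y hY φ =>
    c_imp_b hc k hk hkn A (Mcat_base 𝒜 hA) Y hY _ rfl φ⟩⟩
  intro ha k hk hkn A hA Y hY φ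
  have h := ha k hk hkn A (Mcat_base 𝒜 hA) Y hY φ
  obtain ⟨k, rfl⟩ : ∃ l, k = l + 2 := ⟨k - 2, by omega⟩
  obtain ⟨Z, hZ, α, β, _, h⟩ := h
  exact ⟨Z, hZ, α, _, h⟩
end
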